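/- Let S be a numerical semigroup with gcd(S) = 1. Then S is k-normalescent if and only if there exist ℓ ≥ k and a rank-k integer matrix M ∈ ℤ^{k×ℓ} such that s(M) = S. Furthermore, S is k-ray-normalescent if and only if there exists a full-rank square integer matrix M ∈ ℤ^{k×k} such that s(M) = S. -/

import Mathlib

open scoped BigOperators

/-- The cone generated by the vectors `v i` in `ℝ^m`: all nonnegative real combinations. -/
def coneGen {m l : ℕ} (v : Fin l → (Fin m → ℝ)) : Set (Fin m → ℝ) :=
  {x | ∃ c : Fin l → ℝ, (∀ i, 0 ≤ c i) ∧ x = ∑ i, c i • v i}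

/-- Coercion of an integer vector to a real vector. -/
def toReal {m : ℕ} (z : Fin m → ℤ) : Fin m → ℝ := fun i => (z i : ℝ)

/-- A numerical semigroup: contains 0 and is closed under addition. -/
def IsNumericalSemigroup (S : Set ℕ) : Prop :=
  0 ∈ S ∧ ∀ a ∈ S, ∀ b ∈ S, a + b ∈ S

/-- The numerical semigroup `⟨a 1, …, a n⟩` generated by the `a i`. -/
def numGen {n : ℕ} (a : Fin n → ℕ) : Set ℕ :=
  {t | ∃ x : Fin n → ℕ, t = ∑ i, a i * x i}

/-- The quotient `T/d = {t ∈ ℕ : d t ∈ T}`. -/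
def numQuot (T : Set ℕ) (d : ℕ) : Set ℕ := {t | d * t ∈ T}

/-- `S` is a `k`-quotient: `S = ⟨a 1, …, a k⟩ / d` for positive integers `d, a i`. -/
def IsKQuotient (k : ℕ) (S : Set ℕ) : Prop :=
  ∃ (d : ℕ) (a : Fin k → ℕ), 0 < d ∧ (∀ i, 0 < a i) ∧ S = numQuot (numGen a) d

/-- `S` is `k`-ray-normalescent: `S = π(C ∩ ℤ^m)` where `C ⊆ ℝ^m` is a rational polyhedral
cone generated by `k` integer vectors (so with at most `k` extreme rays) and `π` is a linear
functional with integer coefficients `p` satisfying `π(C) ⊆ ℝ≥0`. -/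
def IsKRayNormalescent (k : ℕ) (S : Set ℕ) : Prop :=
  ∃ (m : ℕ) (v : Fin k → (Fin m → ℤ)) (p : Fin m → ℤ),
    (∀ x ∈ coneGen (fun i => toReal (v i)), 0 ≤ ∑ j, (p j : ℝ) * x j) ∧
    {t : ℤ | ∃ z : Fin m → ℤ, toReal z ∈ coneGen (fun i => toReal (v i)) ∧
        t = ∑ j, p j * z j} = (fun n : ℕ => (n : ℤ)) '' S

/-- `S` is `k`-normalescent: `S = π(C ∩ ℤ^m)` where `C ⊆ ℝ^m` is a `k`-dimensional rational
polyhedral cone and `π` is a linear functional with integer coefficients `p` with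
`π(C) ⊆ ℝ≥0`. -/
def IsKNormalescent (k : ℕ) (S : Set ℕ) : Prop :=
  ∃ (m l : ℕ) (v : Fin l → (Fin m → ℤ)) (p : Fin m → ℤ),
    Module.finrank ℝ (Submodule.span ℝ (Set.range (fun i => toReal (v i)))) = k ∧
    (∀ x ∈ coneGen (fun i => toReal (v i)), 0 ≤ ∑ j, (p j : ℝ) * x j) ∧
    {t : ℤ | ∃ z : Fin m → ℤ, toReal z ∈ coneGen (fun i => toReal (v i)) ∧
        t = ∑ j, p j * z j} = (fun n : ℕ => (n : ℤ)) '' S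

/-- Conic Carathéodory: a nonnegative combination can be rewritten on an independent subfamily. -/
theorem exists_linearIndepOn_nonneg_sum {ι E : Type*} [DecidableEq ι] [AddCommGroup E] [Module ℝ E]
    (v : ι → E) (s : Finset ι) (c : ι → ℝ) (hc : ∀ i ∈ s, 0 ≤ c i) :
    ∃ t ⊆ s, ∃ c' : ι → ℝ, (∀ i ∈ t, 0 ≤ c' i) ∧
      ∑ i ∈ t, c' i • v i = ∑ i ∈ s, c i • v i ∧ LinearIndepOn ℝ v (t : Set ι) := by
  induction s using Finset.strongInduction generalizing c with
  | H s ih =>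
  by_cases hli : LinearIndepOn ℝ v (s : Set ι)
  · exact ⟨s, subset_rfl, c, hc, rfl, hli⟩
  obtain ⟨f, hf, i₁, hi₁, hpos⟩ : ∃ f : ι → ℝ, ∑ i ∈ s, f i • v i = 0 ∧ ∃ i ∈ s, 0 < f i := by
    rw [not_linearIndepOn_finset_iff] at hli
    obtain ⟨f, hf, i, hi, hne⟩ := hli
    rcases hne.lt_or_gt with h | h
    · exact ⟨-f, by simp [hf], i, hi, by simpa using h⟩
    · exact ⟨f, hf, i, hi, h⟩
  obtain ⟨i₀, hi₀, hmin⟩ := Finset.exists_min_image (s.filter fun i => 0 < f i)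
    (fun i => c i / f i) ⟨i₁, by simp [hi₁, hpos]⟩
  rw [Finset.mem_filter] at hi₀
  have ht : 0 ≤ c i₀ / f i₀ := div_nonneg (hc _ hi₀.1) hi₀.2.le
  obtain ⟨t, hts, c', hc', hsum, hind⟩ := ih (s.erase i₀) (Finset.erase_ssubset hi₀.1)
    (fun i => c i - c i₀ / f i₀ * f i) (fun i hi => by
      have his := Finset.mem_of_mem_erase hi
      rcases lt_or_ge 0 (f i) with h | h
      · have := hmin i (by simp [his, h])
        rw [le_div_iff₀ h] at this
        linarith
      · nlinarith [hc i his])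
  refine ⟨t, hts.trans (Finset.erase_subset _ _), c', hc', ?_, hind⟩
  rw [hsum, Finset.sum_erase]
  · simp only [sub_smul, mul_smul, Finset.sum_sub_distrib, ← Finset.smul_sum, hf, smul_zero,
      sub_zero]
  · rw [div_mul_cancel₀ _ hi₀.2.ne', sub_self, zero_smul]

/-- Coefficients of integer vectors over independent integer vectors have bounded denominators. -/
theorem exists_common_denominator {m : ℕ} {ι : Type*} [Fintype ι] [DecidableEq ι]
    (v : ι → Fin m → ℤ) (hv : LinearIndependent ℝ fun i => toReal (v i)) :
    ∃ D : ℕ, 0 < D ∧ ∀ (z : Fin m → ℤ) (c : ι → ℝ), toReal z = ∑ i, c i • toReal (v i) →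
      ∀ i, ∃ n : ℤ, (D : ℝ) * c i = n := by
  let A : Matrix (Fin m) ι ℤ := fun j i => v i j
  let G : Matrix ι ι ℤ := A.transpose * A
  let B : Matrix (Fin m) ι ℝ := A.map (Int.castRingHom ℝ)
  have hG : G.map (Int.castRingHom ℝ) = B.transpose * B := by
    simp only [G, B, Matrix.map_mul, Matrix.transpose_map]
  have hmul (c : ι → ℝ) : B.mulVec c = ∑ i, c i • toReal (v i) := by
    ext j
    simp [B, A, Matrix.mulVec, dotProduct, toReal, mul_comm]
    rfl
  have hdet : G.det ≠ 0 := by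
    intro h0
    have h1 : (B.transpose * B).det = 0 := by
      rw [← hG, ← RingHom.mapMatrix_apply, ← RingHom.map_det, h0, map_zero]
    obtain ⟨c, hc, hz⟩ := Matrix.exists_mulVec_eq_zero_iff.2 h1
    have h2 : B.mulVec c = 0 := by
      have : dotProduct (B.mulVec c) (B.mulVec c) = 0 := by
        rw [Matrix.dotProduct_mulVec, Matrix.vecMul_mulVec, ← Matrix.dotProduct_mulVec, hz,
          dotProduct_zero]
      exact dotProduct_self_eq_zero.1 this
    rw [hmul] at h2
    exact hc (funext (Fintype.linearIndependent_iff.1 hv c h2))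
  refine ⟨G.det.natAbs, Int.natAbs_pos.2 hdet, fun z c h i => ?_⟩
  have key : (G.det : ℝ) * c i =
      ((G.adjugate.mulVec (A.transpose.mulVec z) i : ℤ) : ℝ) := by
    have h1 : (G.map (Int.castRingHom ℝ)).adjugate.mulVec
        ((G.map (Int.castRingHom ℝ)).mulVec c) = (G.det : ℝ) • c := by
      rw [Matrix.mulVec_mulVec, Matrix.adjugate_mul, Matrix.smul_mulVec, Matrix.one_mulVec,
        ← RingHom.mapMatrix_apply, ← RingHom.map_det]
      rfl
    have h2 : (G.map (Int.castRingHom ℝ)).mulVec c =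
        (Int.castRingHom ℝ) ∘ (A.transpose.mulVec z) := by
      rw [hG, ← Matrix.mulVec_mulVec, hmul, ← h]
      ext i
      exact ((Int.castRingHom ℝ).map_mulVec A.transpose z i).symm
    rw [h2, ← RingHom.mapMatrix_apply, ← RingHom.map_adjugate, RingHom.mapMatrix_apply] at h1
    have h3 := congrFun h1 i
    have h4 := (Int.castRingHom ℝ).map_mulVec G.adjugate (A.transpose.mulVec z) i
    simp only [Pi.smul_apply, smul_eq_mul] at h3
    rw [← h3, ← h4]
    rfl
  rcases abs_choice G.det with h | h
  · exact ⟨_, by rw [Nat.cast_natAbs, h, key]⟩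
  · exact ⟨-G.adjugate.mulVec (A.transpose.mulVec z) i, by
      rw [Nat.cast_natAbs, h, Int.cast_neg, neg_mul, key, Int.cast_neg]⟩

/-- Integer points of the cone spanned by integer vectors have nonnegative rational
coordinates with a common denominator. -/
theorem exists_forall_mem_coneGen_smul_eq_sum {m l : ℕ} (v : Fin l → Fin m → ℤ) :
    ∃ D : ℕ, 0 < D ∧ ∀ z : Fin m → ℤ, toReal z ∈ coneGen (fun i => toReal (v i)) →
      ∃ n : Fin l → ℕ, D • z = ∑ i, n i • v i := by
  have hex (s : Finset (Fin l)) : ∃ D : ℕ, 0 < D ∧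
      (LinearIndepOn ℝ (fun i => toReal (v i)) (s : Set (Fin l)) →
        ∀ (z : Fin m → ℤ) (c : Fin l → ℝ), toReal z = ∑ i ∈ s, c i • toReal (v i) →
          ∀ i ∈ s, ∃ n : ℤ, (D : ℝ) * c i = n) := by
    by_cases h : LinearIndepOn ℝ (fun i => toReal (v i)) (s : Set (Fin l))
    · obtain ⟨D, hD, H⟩ := exists_common_denominator (fun i : s => v i) h
      refine ⟨D, hD, fun _ z c hz i hi => H z (fun i => c i) ?_ ⟨i, hi⟩⟩
      rw [hz, ← Finset.sum_coe_sort]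
    · exact ⟨1, one_pos, fun h' => absurd h' h⟩
  choose D hD H using hex
  refine ⟨∏ s, D s, Finset.prod_pos fun s _ => hD s, fun z ⟨c, hc, hz⟩ => ?_⟩
  obtain ⟨t, -, c', hc', hsum, hind⟩ :=
    exists_linearIndepOn_nonneg_sum (fun i => toReal (v i)) Finset.univ c fun i _ => hc i
  have hz' := hz.trans hsum.symm
  have hn (i : Fin l) : ∃ n : ℕ, i ∈ t → ((∏ s, D s : ℕ) : ℝ) * c' i = n := by
    by_cases hi : i ∈ t
    · obtain ⟨n, hn⟩ := H t hind z c' hz' i hi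
      have hn0 : 0 ≤ n := by
        have : (0 : ℝ) ≤ n := hn ▸ mul_nonneg (Nat.cast_nonneg _) (hc' i hi)
        exact_mod_cast this
      obtain ⟨q, hq⟩ := Finset.dvd_prod_of_mem D (Finset.mem_univ t)
      lift n to ℕ using hn0
      refine ⟨q * n, fun _ => ?_⟩
      rw [hq]
      push_cast at hn ⊢
      rw [← hn]
      ring
    · exact ⟨0, fun h => absurd h hi⟩
  choose n hn using hn
  refine ⟨fun i => if i ∈ t then n i else 0, ?_⟩
  ext j
  have hj := congrFun hz' j
  simp only [toReal, Finset.sum_apply, Pi.smul_apply, smul_eq_mul] at hj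
  have : ((∏ s, D s : ℕ) : ℝ) * z j = ∑ i ∈ t, (n i : ℝ) * v i j := by
    rw [hj, Finset.mul_sum]
    exact Finset.sum_congr rfl fun i hi => by rw [← hn i hi, mul_assoc]
  rw [Finset.sum_apply]
  simp only [Pi.smul_apply, ite_smul, zero_smul, Finset.sum_ite_mem, Finset.univ_inter,
    nsmul_eq_mul]
  exact_mod_cast this

theorem toReal_mem_coneGen_of_smul_eq_sum {m l : ℕ} {v : Fin l → Fin m → ℤ} {z : Fin m → ℤ}
    {D : ℕ} (hD : 0 < D) {n : Fin l → ℕ} (h : D • z = ∑ i, n i • v i) :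
    toReal z ∈ coneGen (fun i => toReal (v i)) := by
  refine ⟨fun i => n i / D, fun i => by positivity, ?_⟩
  have hD' : (D : ℝ) ≠ 0 := by positivity
  ext j
  have hj := congrFun h j
  simp only [Pi.smul_apply, Finset.sum_apply, nsmul_eq_mul] at hj
  have hj' : (D : ℝ) * z j = ∑ i, (n i : ℝ) * v i j := by exact_mod_cast hj
  simp only [toReal, Finset.sum_apply, Pi.smul_apply, smul_eq_mul, div_mul_eq_mul_div,
    ← Finset.sum_div]
  rw [← hj']
  field_simp

theorem toReal_mem_coneGen_iff {m l : ℕ} {v : Fin l → Fin m → ℤ} {z : Fin m → ℤ} :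
    toReal z ∈ coneGen (fun i => toReal (v i)) ↔
      ∃ D : ℕ, 0 < D ∧ ∃ n : Fin l → ℕ, D • z = ∑ i, n i • v i := by
  refine ⟨fun h => ?_, fun ⟨_, hD, _, h⟩ => toReal_mem_coneGen_of_smul_eq_sum hD h⟩
  obtain ⟨D, hD, H⟩ := exists_forall_mem_coneGen_smul_eq_sum v
  exact ⟨D, hD, H z h⟩

/-- The inclusion `ℤ^m → ℝ^m` as a linear map over `ℤ`. -/
def toRealLinearMap (m : ℕ) : (Fin m → ℤ) →ₗ[ℤ] (Fin m → ℝ) where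
  toFun := toReal
  map_add' x y := by ext; simp [toReal]
  map_smul' a x := by ext; simp [toReal]

/-- The lattice of integer points in the real span of the vectors `v i`. -/
def latticeSpan {m l : ℕ} (v : Fin l → Fin m → ℤ) : Submodule ℤ (Fin m → ℤ) :=
  ((Submodule.span ℝ (Set.range fun i => toReal (v i))).restrictScalars ℤ).comap
    (toRealLinearMap m)

theorem mem_latticeSpan {m l : ℕ} {v : Fin l → Fin m → ℤ} {z : Fin m → ℤ} :
    z ∈ latticeSpan v ↔ toReal z ∈ Submodule.span ℝ (Set.range fun i => toReal (v i)) :=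
  Iff.rfl

theorem mem_latticeSpan_self {m l : ℕ} (v : Fin l → Fin m → ℤ) (i : Fin l) :
    v i ∈ latticeSpan v :=
  mem_latticeSpan.2 (Submodule.subset_span ⟨i, rfl⟩)

theorem mem_latticeSpan_of_mem_coneGen {m l : ℕ} {v : Fin l → Fin m → ℤ} {z : Fin m → ℤ}
    (h : toReal z ∈ coneGen fun i => toReal (v i)) : z ∈ latticeSpan v := by
  obtain ⟨c, -, hz⟩ := h
  rw [mem_latticeSpan, hz]
  exact Submodule.sum_mem _ fun i _ => Submodule.smul_mem _ _ (Submodule.subset_span ⟨i, rfl⟩)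

theorem Module.Basis.toReal_eq_sum {m n : ℕ} {L : Submodule ℤ (Fin m → ℤ)}
    (b : Module.Basis (Fin n) ℤ L) (x : L) :
    toReal (x : Fin m → ℤ) = ∑ r, (b.repr x r : ℝ) • toReal (b r : Fin m → ℤ) := by
  ext j
  have := congrArg (fun y : L => (y : Fin m → ℤ) j) (b.sum_repr x)
  simp only [Submodule.coe_sum, Submodule.coe_smul, Finset.sum_apply, Pi.smul_apply,
    smul_eq_mul] at this
  simp only [toReal, Finset.sum_apply, Pi.smul_apply, smul_eq_mul, ← this]
  push_cast
  rfl

theorem Module.Basis.linearIndependent_toReal {m n : ℕ} {L : Submodule ℤ (Fin m → ℤ)}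
    (b : Module.Basis (Fin n) ℤ L) :
    LinearIndependent ℝ fun r => toReal (b r : Fin m → ℤ) := by
  have hb : LinearIndependent ℤ fun r => (b r : Fin m → ℤ) :=
    b.linearIndependent.map' L.subtype (Submodule.ker_subtype _)
  have h := (linearIndependent_algebraMap_comp_iff (S := ℝ)).2 hb
  have heq (z : Fin m → ℤ) : toReal z = algebraMap ℤ ℝ ∘ z := by
    ext
    simp [toReal]
  simpa only [heq] using h

theorem finrank_span_toReal_eq_card_basis_latticeSpan {m l n : ℕ} (v : Fin l → Fin m → ℤ)
    (b : Module.Basis (Fin n) ℤ (latticeSpan v)) :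
    Module.finrank ℝ (Submodule.span ℝ (Set.range fun i => toReal (v i))) = n := by
  have hli := b.linearIndependent_toReal
  have hspan : Submodule.span ℝ (Set.range fun i => toReal (v i)) =
      Submodule.span ℝ (Set.range fun r => toReal (b r : Fin m → ℤ)) := by
    apply le_antisymm <;> rw [Submodule.span_le]
    · rintro _ ⟨i, rfl⟩
      have := b.toReal_eq_sum ⟨v i, mem_latticeSpan_self v i⟩
      simp only at this
      simp only [this]
      exact Submodule.sum_mem _ fun r _ =>
        Submodule.smul_mem _ _ (Submodule.subset_span ⟨r, rfl⟩)
    · rintro _ ⟨r, rfl⟩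
      exact mem_latticeSpan.1 (b r).2
  rw [hspan, finrank_span_eq_card hli, Fintype.card_fin]

/-- The matrix of coordinates of the `v i` in a lattice basis has the rank of the span. -/
theorem rank_repr_latticeSpan {m l n : ℕ} (v : Fin l → Fin m → ℤ)
    (b : Module.Basis (Fin n) ℤ (latticeSpan v)) :
    ((Matrix.of fun r i => b.repr ⟨v i, mem_latticeSpan_self v i⟩ r).map
      (Int.cast : ℤ → ℝ)).rank = n := by
  set N := (Matrix.of fun r i => b.repr ⟨v i, mem_latticeSpan_self v i⟩ r).map
    (Int.cast : ℤ → ℝ)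
  let B : Matrix (Fin m) (Fin n) ℝ := Matrix.of fun j r => toReal (b r : Fin m → ℤ) j
  have hcol : (B * N).col = fun i => toReal (v i) := by
    ext i j
    have := congrFun (b.toReal_eq_sum ⟨v i, mem_latticeSpan_self v i⟩) j
    simp only [Finset.sum_apply, Pi.smul_apply, smul_eq_mul] at this
    rw [this]
    simp [Matrix.col, Matrix.mul_apply, B, N, mul_comm]
  refine le_antisymm (N.rank_le_height) ?_
  calc n = (B * N).rank := by
        rw [Matrix.rank_eq_finrank_span_cols, hcol,
          finrank_span_toReal_eq_card_basis_latticeSpan v b]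
    _ ≤ N.rank := Matrix.rank_mul_le_right _ _

/-- A finite free `ℤ`-module with a surjective functional `f` has a basis whose
first coordinate function is `f`. -/
theorem exists_basis_repr_zero_eq {L : Type*} [AddCommGroup L] [Module.Free ℤ L]
    [Module.Finite ℤ L] (f : L →ₗ[ℤ] ℤ) (hf : Function.Surjective f) :
    ∃ (n : ℕ) (b : Module.Basis (Fin (n + 1)) ℤ L), ∀ x, b.repr x 0 = f x := by
  obtain ⟨y, hy⟩ := hf 1
  let b := Module.Basis.mkFinCons y (Module.finBasis ℤ (LinearMap.ker f))
    (fun c x hx h => by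
      have := congrArg f h
      simpa [hy, LinearMap.mem_ker.1 hx] using this)
    (fun z => ⟨-f z, by simp [LinearMap.mem_ker, hy]⟩)
  refine ⟨_, b, fun x => ?_⟩
  have h0 : b.coord 0 = f := by
    refine b.ext fun i => ?_
    rw [Module.Basis.coord_apply, Module.Basis.repr_self]
    refine Fin.cases ?_ (fun i => ?_) i
    · simp [b, Module.Basis.coe_mkFinCons, hy]
    · simp [b, Module.Basis.coe_mkFinCons]
  exact LinearMap.congr_fun h0 x

/-- The linear functional on `ℤ^m` with coefficients `p`. -/
def dotLinearMap {m : ℕ} (p : Fin m → ℤ) : (Fin m → ℤ) →ₗ[ℤ] ℤ :=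
  dotProductBilin ℤ ℤ p

theorem exists_matrix_of_cone {k m l : ℕ} (hk : 0 < k) {S : Set ℕ}
    (hgcd : ∀ e : ℕ, (∀ s ∈ S, e ∣ s) → e = 1) (v : Fin l → Fin m → ℤ) (p : Fin m → ℤ)
    (hrank : Module.finrank ℝ (Submodule.span ℝ (Set.range fun i => toReal (v i))) = k)
    (hS : {t : ℤ | ∃ z : Fin m → ℤ, toReal z ∈ coneGen (fun i => toReal (v i)) ∧
        t = ∑ j, p j * z j} = (fun n : ℕ => (n : ℤ)) '' S) :
    ∃ M : Matrix (Fin k) (Fin l) ℤ, (M.map (Int.cast : ℤ → ℝ)).rank = k ∧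
      {t : ℤ | ∃ z : Fin k → ℤ,
          toReal z ∈ coneGen (fun i => toReal (fun r => M r i)) ∧ t = z ⟨0, hk⟩}
        = (fun n : ℕ => (n : ℤ)) '' S := by
  let f : latticeSpan v →ₗ[ℤ] ℤ := dotLinearMap p ∘ₗ (latticeSpan v).subtype
  have hfapp (x : latticeSpan v) : f x = ∑ j, p j * (x : Fin m → ℤ) j := rfl
  have hf : Function.Surjective f := by
    obtain ⟨g, hg⟩ := (IsPrincipalIdealRing.principal (LinearMap.range f)).principal
    have hg1 : g.natAbs = 1 := by
      refine hgcd _ fun s hs => ?_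
      have hs' : (s : ℤ) ∈ (fun n : ℕ => (n : ℤ)) '' S := ⟨s, hs, rfl⟩
      rw [← hS] at hs'
      obtain ⟨z, hz, hsz⟩ := hs'
      have hmem : (s : ℤ) ∈ LinearMap.range f :=
        ⟨⟨z, mem_latticeSpan_of_mem_coneGen hz⟩, by rw [hfapp, hsz]⟩
      rw [hg] at hmem
      exact Int.natAbs_dvd_natAbs.2 (Ideal.mem_span_singleton.1 hmem)
    rw [← LinearMap.range_eq_top, hg]
    exact Ideal.span_singleton_eq_top.2 (Int.isUnit_iff_natAbs_eq.2 hg1)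
  obtain ⟨n, b, hb⟩ := exists_basis_repr_zero_eq f hf
  obtain rfl : n + 1 = k := by
    rw [← hrank, finrank_span_toReal_eq_card_basis_latticeSpan v b]
  refine ⟨_, rank_repr_latticeSpan v b, ?_⟩
  rw [← hS]
  have hcone (x : latticeSpan v) :
      toReal (b.equivFun x) ∈ coneGen (fun i => toReal fun r =>
          (Matrix.of fun r i => b.repr ⟨v i, mem_latticeSpan_self v i⟩ r) r i) ↔
        toReal (x : Fin m → ℤ) ∈ coneGen fun i => toReal (v i) := by
    rw [toReal_mem_coneGen_iff, toReal_mem_coneGen_iff]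
    refine exists_congr fun D => and_congr_right fun _ => exists_congr fun c => ?_
    have h1 : (∑ i, c i • fun r =>
        (Matrix.of fun r i => b.repr ⟨v i, mem_latticeSpan_self v i⟩ r) r i) =
          b.equivFun (∑ i, c i • ⟨v i, mem_latticeSpan_self v i⟩) := by
      simp only [map_sum, map_nsmul]
      rfl
    have h2 : (∑ i, c i • v i) =
        ((∑ i, c i • ⟨v i, mem_latticeSpan_self v i⟩ : latticeSpan v) : Fin m → ℤ) := by
      simp
    rw [h1, h2, ← map_nsmul, b.equivFun.injective.eq_iff, ← Submodule.coe_smul_of_tower,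
      Subtype.coe_injective.eq_iff]
  ext t
  constructor
  · rintro ⟨z, hz, rfl⟩
    obtain ⟨x, rfl⟩ := b.equivFun.surjective z
    exact ⟨x, (hcone x).1 hz, hb x⟩
  · rintro ⟨z, hz, rfl⟩
    have hzL := mem_latticeSpan_of_mem_coneGen hz
    exact ⟨b.equivFun ⟨z, hzL⟩, (hcone ⟨z, hzL⟩).2 hz, (hb ⟨z, hzL⟩).symm⟩

/-- Adjoining multiples of the standard basis makes a family of generators independent without
changing the projection of the integer points of its cone. -/
theorem exists_linearIndependent_lift {k m : ℕ} (v : Fin k → Fin m → ℤ) (p : Fin m → ℤ) :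
    ∃ (w : Fin k → Fin (m + k) → ℤ) (q : Fin (m + k) → ℤ),
      LinearIndependent ℝ (fun i => toReal (w i)) ∧
      {t : ℤ | ∃ z : Fin (m + k) → ℤ, toReal z ∈ coneGen (fun i => toReal (w i)) ∧
          t = ∑ j, q j * z j} =
        {t : ℤ | ∃ z : Fin m → ℤ, toReal z ∈ coneGen (fun i => toReal (v i)) ∧
          t = ∑ j, p j * z j} := by
  obtain ⟨D, hD, H⟩ := exists_forall_mem_coneGen_smul_eq_sum v
  refine ⟨fun i => Fin.append (v i) (Pi.single i (D : ℤ)), Fin.append p 0, ?_, ?_⟩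
  · rw [Fintype.linearIndependent_iff]
    intro c hc i
    have := congrFun hc (Fin.natAdd m i)
    simpa [toReal, Pi.single_apply, hD.ne'] using this
  ext t
  constructor
  · rintro ⟨z, ⟨c, hc, hz⟩, rfl⟩
    refine ⟨fun j => z (Fin.castAdd k j), ⟨c, hc, ?_⟩, by simp [Fin.sum_univ_add]⟩
    ext j
    have := congrFun hz (Fin.castAdd k j)
    simpa [toReal] using this
  · rintro ⟨z, hz, rfl⟩
    obtain ⟨n, hn⟩ := H z hz
    refine ⟨Fin.append z (fun i => (n i : ℤ)),
      toReal_mem_coneGen_of_smul_eq_sum hD (n := n) ?_, by simp [Fin.sum_univ_add]⟩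
    ext j
    refine Fin.addCases (fun j => ?_) (fun j => ?_) j
    · simpa using congrFun hn j
    · simp [Pi.single_apply, mul_comm]

theorem nonneg_of_mem_coneGen_of_image_eq {k l : ℕ} (i₀ : Fin k) {S : Set ℕ}
    (M : Matrix (Fin k) (Fin l) ℤ)
    (hM : {t : ℤ | ∃ z : Fin k → ℤ,
        toReal z ∈ coneGen (fun i => toReal (fun r => M r i)) ∧ t = z i₀}
      = (fun n : ℕ => (n : ℤ)) '' S) :
    ∀ x ∈ coneGen (fun i => toReal (fun r => M r i)), 0 ≤ x i₀ := by
  rintro _ ⟨c, hc, rfl⟩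
  rw [Finset.sum_apply]
  refine Finset.sum_nonneg fun i _ => mul_nonneg (hc i) ?_
  have : M i₀ i ∈ (fun n : ℕ => (n : ℤ)) '' S := by
    rw [← hM]
    exact ⟨fun r => M r i, ⟨Pi.single i 1, fun j => by
      by_cases h : j = i <;> simp [h], by simp [Pi.single_apply]⟩, rfl⟩
  obtain ⟨n, -, hn⟩ := this
  simp [toReal, ← hn]

/-- for a numerical semigroup `S` with `gcd(S) = 1`, `S` is `k`-normalescent
iff `s(M) = S` for some rank-`k` integer matrix `M ∈ ℤ^{k×ℓ}` with `ℓ ≥ k`, and `S` is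
`k`-ray-normalescent iff `s(M) = S` for some full-rank square integer matrix `M ∈ ℤ^{k×k}`.
Here `s(M)` is the image of the integer points of the cone generated by the columns of `M`
under projection to the first coordinate. -/
theorem normalescent_iff_matrix (k : ℕ) (hk : 0 < k) (S : Set ℕ)
    (hS : IsNumericalSemigroup S) (hgcd : ∀ e : ℕ, (∀ s ∈ S, e ∣ s) → e = 1) :
    (IsKNormalescent k S ↔
      ∃ (l : ℕ), k ≤ l ∧ ∃ M : Matrix (Fin k) (Fin l) ℤ,
        (M.map (Int.cast : ℤ → ℝ)).rank = k ∧
        {t : ℤ | ∃ z : Fin k → ℤ,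
            toReal z ∈ coneGen (fun i => toReal (fun r => M r i)) ∧ t = z ⟨0, hk⟩}
          = (fun n : ℕ => (n : ℤ)) '' S) ∧
    (IsKRayNormalescent k S ↔
      ∃ M : Matrix (Fin k) (Fin k) ℤ,
        (M.map (Int.cast : ℤ → ℝ)).rank = k ∧
        {t : ℤ | ∃ z : Fin k → ℤ,
            toReal z ∈ coneGen (fun i => toReal (fun r => M r i)) ∧ t = z ⟨0, hk⟩}
          = (fun n : ℕ => (n : ℤ)) '' S) := by
  have hray (l : ℕ) (M : Matrix (Fin k) (Fin l) ℤ)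
      (hM : {t : ℤ | ∃ z : Fin k → ℤ,
          toReal z ∈ coneGen (fun i => toReal (fun r => M r i)) ∧ t = z ⟨0, hk⟩}
        = (fun n : ℕ => (n : ℤ)) '' S) :
      (∀ x ∈ coneGen (fun i => toReal (fun r => M r i)),
        0 ≤ ∑ j, (((Pi.single ⟨0, hk⟩ 1 : Fin k → ℤ) j : ℤ) : ℝ) * x j) ∧
      {t : ℤ | ∃ z : Fin k → ℤ, toReal z ∈ coneGen (fun i => toReal (fun r => M r i)) ∧
        t = ∑ j, (Pi.single ⟨0, hk⟩ 1 : Fin k → ℤ) j * z j} =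
          (fun n : ℕ => (n : ℤ)) '' S := by
    refine ⟨fun x hx => ?_, ?_⟩
    · simpa [Pi.single_apply] using nonneg_of_mem_coneGen_of_image_eq _ M hM x hx
    · simpa [Pi.single_apply] using hM
  refine ⟨⟨?_, ?_⟩, ⟨?_, ?_⟩⟩
  · rintro ⟨m, l, v, p, hrank, -, hv⟩
    obtain ⟨M, hM, hMS⟩ := exists_matrix_of_cone hk hgcd v p hrank hv
    exact ⟨l, hM ▸ Matrix.rank_le_width _, M, hM, hMS⟩
  · rintro ⟨l, -, M, hM, hMS⟩
    refine ⟨k, l, fun i r => M r i, Pi.single ⟨0, hk⟩ 1, ?_, hray l M hMS⟩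
    rw [Matrix.rank_eq_finrank_span_cols] at hM
    exact hM
  · rintro ⟨m, v, p, -, hv⟩
    obtain ⟨w, q, hw, hwv⟩ := exists_linearIndependent_lift v p
    exact exists_matrix_of_cone hk hgcd w q
      (by rw [finrank_span_eq_card hw, Fintype.card_fin]) (hwv.trans hv)
  · rintro ⟨M, -, hMS⟩
    exact ⟨k, fun i r => M r i, Pi.single ⟨0, hk⟩ 1, hray k M hMS⟩
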